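/- arXiv:2411.03230 — 4 statements merged into one kernel-verified Lean document; each statement's English description precedes it below -/
import Mathlib

section
/- The four encoded two-qubit states |bb'⟩_enc (b,b' ∈ {0,1}) are orthonormal, lie in the two-particle constrained subspace, satisfy (Π_c H₀ Π_c)|bb'⟩_enc = 0, every vector v in the two-particle constrained subspace with (Π_c H₀ Π_c)v = 0 is a linear combination of the four encoded states, and every vector v in the two-particle constrained subspace orthogonal to all four encoded states satisfies ⟨v, H₀ v⟩ ≥ ⟨v, v⟩. -/
open Matrix
open scoped Kronecker

noncomputable section

/-- Index type for the Fock space of 9 fermionic modes, `ℂ^512`.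
Modes `i1,i2,i3,j1,j2,j3,x,y,z` are labelled `0,…,8` in this order. -/
abbrev Idx := Fin 9 → Bool

abbrev Mat := Matrix Idx Idx ℂ

/-- Jordan–Wigner annihilation operator `a_k = Z^{⊗(k-1)} ⊗ σ⁻ ⊗ I^{⊗(9-k)}`,
written entrywise in the occupation-number basis (`false` = unoccupied `|0⟩`). -/
def a (k : Fin 9) : Mat :=
  Matrix.of fun s t =>
    if t k = true ∧ s = Function.update t k false then
      (-1 : ℂ) ^ (Finset.univ.filter fun l => l < k ∧ t l = true).card
    else 0

/-- Creation operator `a_k†`. -/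
def ad (k : Fin 9) : Mat := (a k)ᴴ

/-- The vacuum state `|vac⟩ = |0⟩^{⊗9}`. -/
def vac : Idx → ℂ := fun t => if t = (fun _ => false) then 1 else 0

/-- `√3` as a complex number. -/
def s3 : ℂ := (Real.sqrt 3 : ℝ)

/-- The edges of the constraint graph `G_c`:
`{i1,i2},{i2,i3},{i1,i3},{j1,j2},{j2,j3},{j1,j3},{i2,x},{j2,x},{i3,y},{j3,y},{i1,z},{j1,z}`. -/
def edges : Finset (Fin 9 × Fin 9) :=
  {(0,1), (1,2), (0,2), (3,4), (4,5), (3,5), (1,6), (4,6), (2,7), (5,7), (0,8), (3,8)}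

/-- Adjacency in the constraint graph `G_c`. -/
def Adj (k l : Fin 9) : Prop := (k, l) ∈ edges ∨ (l, k) ∈ edges

instance (k l : Fin 9) : Decidable (Adj k l) := by unfold Adj; infer_instance

/-- `S` is an independent set of the constraint graph `G_c`. -/
def IndepSet (S : Finset (Fin 9)) : Prop := ∀ k ∈ S, ∀ l ∈ S, ¬ Adj k l

instance (S : Finset (Fin 9)) : Decidable (IndepSet S) := by unfold IndepSet; infer_instance

/-- The Fock basis state `|S⟩` with exactly the modes in `S` occupied. -/
def fock (S : Finset (Fin 9)) : Idx → ℂ :=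
  fun t => if t = (fun k => decide (k ∈ S)) then 1 else 0

/-- The set of occupied modes of an occupation vector. -/
def suppOf (t : Idx) : Finset (Fin 9) := Finset.univ.filter fun k => t k = true

/-- The two-particle constrained subspace: the span of the Fock states `|S⟩` over
independent sets `S` of `G_c` with `|S| = 2`. -/
def C2 : Submodule ℂ (Idx → ℂ) :=
  Submodule.span ℂ {v | ∃ S : Finset (Fin 9), IndepSet S ∧ S.card = 2 ∧ v = fock S}

/-- `Π_c`, the orthogonal projector onto the two-particle constrained subspace.
Since that subspace is spanned by standard (Fock) basis vectors, the orthogonal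
projector is the diagonal 0/1 matrix supported on those coordinates. -/
def Pic : Mat :=
  Matrix.diagonal fun t => if IndepSet (suppOf t) ∧ (suppOf t).card = 2 then 1 else 0

/-- `H_{0,i} = I + (a_{i1}†a_{i2}+h.c.) + (a_{i2}†a_{i3}+h.c.) + (a_{i3}†a_{i1}+h.c.)`. -/
def H0i : Mat :=
  1 + (ad 0 * a 1 + ad 1 * a 0) + (ad 1 * a 2 + ad 2 * a 1) + (ad 2 * a 0 + ad 0 * a 2)

/-- `H_{0,j}`, defined analogously on modes `j1,j2,j3`. -/
def H0j : Mat :=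
  1 + (ad 3 * a 4 + ad 4 * a 3) + (ad 4 * a 5 + ad 5 * a 4) + (ad 5 * a 3 + ad 3 * a 5)

/-- `H₀ = H_{0,i} + H_{0,j}`. -/
def H0 : Mat := H0i + H0j

/-- `S_{·,b}` on modes `k1,k2,k3`:
`S_{·,0} = (1/(2√3))((1−√3)a_{k3}† − 2a_{k1}† + (1+√3)a_{k2}†)` and
`S_{·,1} = (1/(2√3))((1+√3)a_{k3}† − 2a_{k1}† + (1−√3)a_{k2}†)`. -/
def Senc (k1 k2 k3 : Fin 9) (b : Fin 2) : Mat :=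
  if b = 0 then
    (1 / (2 * s3)) • ((1 - s3) • ad k3 - (2 : ℂ) • ad k1 + (1 + s3) • ad k2)
  else
    (1 / (2 * s3)) • ((1 + s3) • ad k3 - (2 : ℂ) • ad k1 + (1 - s3) • ad k2)

/-- The encoded two-qubit state `|bb'⟩_enc = S_{i,b} S_{j,b'} |vac⟩`. -/
def enc (b b' : Fin 2) : Idx → ℂ := (Senc 0 1 2 b * Senc 3 4 5 b').mulVec vac

/-- The encoding isometry `E : ℂ⁴ → ℂ^512`, sending `|b⟩⊗|b'⟩` to `|bb'⟩_enc`. -/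
def Eenc : Matrix Idx (Fin 2 × Fin 2) ℂ := Matrix.of fun t p => enc p.1 p.2 t

/-- `Π₋ = E E†`, the orthogonal projector onto the span of the four encoded states. -/
def Pim : Mat := Eenc * Eencᴴ

/-- `Π₊ = Π_c − Π₋`. -/
def Pip : Mat := Pic - Pim

/-- `V₁ = (a_{i2}†a_x+h.c.) + (a_{j2}†a_x+h.c.) + (a_{i3}†a_y+h.c.) + (a_{j3}†a_y+h.c.)`. -/
def V1 : Mat :=
  (ad 1 * a 6 + ad 6 * a 1) + (ad 4 * a 6 + ad 6 * a 4)
    + (ad 2 * a 7 + ad 7 * a 2) + (ad 5 * a 7 + ad 7 * a 5)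

/-- `V₂ = (a_{i1}†a_z+h.c.) + (a_{j1}†a_z+h.c.)`. -/
def V2 : Mat := (ad 0 * a 8 + ad 8 * a 0) + (ad 3 * a 8 + ad 8 * a 3)

/-- `V_main = V₁ + V₂`. -/
def Vmain : Mat := V1 + V2

/-- The Pauli matrix `X`. -/
def PX : Matrix (Fin 2) (Fin 2) ℂ := !![0, 1; 1, 0]

/-- The Pauli matrix `Z`. -/
def PZ : Matrix (Fin 2) (Fin 2) ℂ := !![1, 0; 0, -1]

/-- The occupation vector with exactly the modes `k` and `l` occupied. -/
def pairOcc (k l : Fin 9) : Idx := fun m => decide (m = k ∨ m = l)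

lemma pairOcc_comm (k l : Fin 9) : pairOcc k l = pairOcc l k := by
  funext m; simp [pairOcc, or_comm]

/-- The Jordan–Wigner sign of mode `k` in the occupation vector `t`. -/
def jwSign (k : Fin 9) (t : Idx) : ℂ :=
  (-1 : ℂ) ^ (Finset.univ.filter fun l => l < k ∧ t l = true).card

lemma jwSign_congr {k : Fin 9} {s t : Idx} (h : ∀ l < k, s l = t l) :
    jwSign k s = jwSign k t := by
  unfold jwSign
  congr 2
  ext l
  simp only [Finset.mem_filter, Finset.mem_univ, true_and]
  exact and_congr_right fun hl => by rw [h l hl]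

lemma a_mulVec (j : Fin 9) (v : Idx → ℂ) (s : Idx) :
    (a j *ᵥ v) s = if s j = false then jwSign j s * v (Function.update s j true) else 0 := by
  simp only [mulVec, dotProduct, a, Matrix.of_apply]
  rw [Finset.sum_eq_single (Function.update s j true)]
  · by_cases h : s j = false
    · have h' : s = Function.update s j false := by rw [← h, Function.update_eq_self]
      simp only [Function.update_self, Function.update_idem, true_and, if_pos h, if_pos h']
      congr 1
      exact jwSign_congr (k := j) fun l hl => Function.update_of_ne hl.ne _ _
    · have h' : ¬ s = Function.update s j false := fun e => h (by rw [e]; simp)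
      simp [h, h']
  · intro t _ ht
    rw [if_neg, zero_mul]
    rintro ⟨h1, rfl⟩
    apply ht
    rw [Function.update_idem, ← h1, Function.update_eq_self]
  · simp

lemma ad_mulVec (i : Fin 9) (v : Idx → ℂ) (s : Idx) :
    (ad i *ᵥ v) s = if s i = true then jwSign i s * v (Function.update s i false) else 0 := by
  simp only [mulVec, dotProduct, ad, a, Matrix.conjTranspose_apply, Matrix.of_apply]
  rw [Finset.sum_eq_single (Function.update s i false)]
  · by_cases h : s i = true <;> simp [h, jwSign]
  · intro t _ ht
    rw [if_neg (fun h => ht h.2)]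
    simp
  · simp

lemma jwSign_pairOcc (i m : Fin 9) :
    jwSign i (pairOcc i m) = if m < i then -1 else 1 := by
  have : (Finset.univ.filter fun l => l < i ∧ pairOcc i m l = true)
      = if m < i then {m} else ∅ := by
    ext l
    split_ifs with hm <;>
    simp only [pairOcc, Finset.mem_filter, Finset.mem_univ, true_and, decide_eq_true_eq,
      Finset.mem_singleton, Finset.notMem_empty, iff_false] <;> grind
  unfold jwSign
  rw [this]
  split_ifs <;> simp

/-- Hopping moves a particle from `j` to `i` without a sign when the other particle is not
between the two modes. -/
lemma hop_pairOcc {i j m : Fin 9} (hij : i ≠ j) (him : i ≠ m) (hjm : j ≠ m)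
    (h : m < i ↔ m < j) (v : Idx → ℂ) :
    ((ad i * a j) *ᵥ v) (pairOcc i m) = v (pairOcc j m) := by
  rw [← mulVec_mulVec, ad_mulVec, a_mulVec]
  have e : Function.update (Function.update (pairOcc i m) i false) j true = pairOcc j m := by
    funext l
    simp only [Function.update_apply, pairOcc]
    grind
  have hs : jwSign j (Function.update (pairOcc i m) i false) = jwSign j (pairOcc j m) :=
    jwSign_congr fun l hl => by
      simp only [Function.update_apply, pairOcc]
      grind
  have hi : pairOcc i m i = true := by simp [pairOcc]
  have hj : Function.update (pairOcc i m) i false j = false := by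
    simp only [Function.update_apply, pairOcc]
    grind
  rw [e, hs, if_pos hi, if_pos hj, jwSign_pairOcc, jwSign_pairOcc]
  by_cases hm : m < j <;> simp [h, hm]

lemma hop_pairOcc_eq_zero {i j k m : Fin 9} (hk : i ≠ k) (hm : i ≠ m) (v : Idx → ℂ) :
    ((ad i * a j) *ᵥ v) (pairOcc k m) = 0 := by
  rw [← mulVec_mulVec, ad_mulVec, if_neg (by simp [pairOcc, hk, hm])]

lemma H0i_mulVec_of_mem {k m : Fin 9} (hk : k < 3) (hm : 3 ≤ m) (v : Idx → ℂ) :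
    (H0i *ᵥ v) (pairOcc k m) = v (pairOcc 0 m) + v (pairOcc 1 m) + v (pairOcc 2 m) := by
  have h0 : (0 : Fin 9) ≠ m := by grind
  have h1 : (1 : Fin 9) ≠ m := by grind
  have h2 : (2 : Fin 9) ≠ m := by grind
  have hl0 : ¬ m < 0 := by grind
  have hl1 : ¬ m < 1 := by grind
  have hl2 : ¬ m < 2 := by grind
  have hk' : k = 0 ∨ k = 1 ∨ k = 2 := by grind
  simp only [H0i, add_mulVec, one_mulVec, Pi.add_apply]
  rcases hk' with rfl | rfl | rfl <;>
    simp [hop_pairOcc, hop_pairOcc_eq_zero, h0, h1, h2, hl0, hl1, hl2] <;> ring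

lemma H0i_mulVec_of_notMem {k m : Fin 9} (hk : 3 ≤ k) (hm : 3 ≤ m) (v : Idx → ℂ) :
    (H0i *ᵥ v) (pairOcc k m) = v (pairOcc k m) := by
  have h0 : (0 : Fin 9) ≠ m := by grind
  have h1 : (1 : Fin 9) ≠ m := by grind
  have h2 : (2 : Fin 9) ≠ m := by grind
  have h0' : (0 : Fin 9) ≠ k := by grind
  have h1' : (1 : Fin 9) ≠ k := by grind
  have h2' : (2 : Fin 9) ≠ k := by grind
  simp only [H0i, add_mulVec, one_mulVec, Pi.add_apply]
  simp [hop_pairOcc_eq_zero, h0, h1, h2, h0', h1', h2']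

lemma H0j_mulVec_of_mem {k m : Fin 9} (hk : 3 ≤ k ∧ k < 6) (hm : m < 3 ∨ 6 ≤ m) (v : Idx → ℂ) :
    (H0j *ᵥ v) (pairOcc k m) = v (pairOcc 3 m) + v (pairOcc 4 m) + v (pairOcc 5 m) := by
  have h3 : (3 : Fin 9) ≠ m := by grind
  have h4 : (4 : Fin 9) ≠ m := by grind
  have h5 : (5 : Fin 9) ≠ m := by grind
  have h34 : m < 3 ↔ m < 4 := by grind
  have h45 : m < 4 ↔ m < 5 := by grind
  have hk' : k = 3 ∨ k = 4 ∨ k = 5 := by grind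
  simp only [H0j, add_mulVec, one_mulVec, Pi.add_apply]
  rcases hk' with rfl | rfl | rfl <;>
    simp [hop_pairOcc, hop_pairOcc_eq_zero, h3, h4, h5, h34, h45] <;> ring

lemma H0j_mulVec_of_notMem {k m : Fin 9} (hk : k < 3 ∨ 6 ≤ k) (hm : m < 3 ∨ 6 ≤ m)
    (v : Idx → ℂ) : (H0j *ᵥ v) (pairOcc k m) = v (pairOcc k m) := by
  have h3 : (3 : Fin 9) ≠ m := by grind
  have h4 : (4 : Fin 9) ≠ m := by grind
  have h5 : (5 : Fin 9) ≠ m := by grind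
  have h3' : (3 : Fin 9) ≠ k := by grind
  have h4' : (4 : Fin 9) ≠ k := by grind
  have h5' : (5 : Fin 9) ≠ k := by grind
  simp only [H0j, add_mulVec, one_mulVec, Pi.add_apply]
  simp [hop_pairOcc_eq_zero, h3, h4, h5, h3', h4', h5']

lemma H0_mulVec_ij {k l : Fin 9} (hk : k < 3) (hl : 3 ≤ l ∧ l < 6) (v : Idx → ℂ) :
    (H0 *ᵥ v) (pairOcc k l) =
      (v (pairOcc 0 l) + v (pairOcc 1 l) + v (pairOcc 2 l)) +
        (v (pairOcc k 3) + v (pairOcc k 4) + v (pairOcc k 5)) := by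
  rw [H0, add_mulVec, Pi.add_apply, H0i_mulVec_of_mem hk hl.1, pairOcc_comm k l,
    H0j_mulVec_of_mem hl (Or.inl hk), pairOcc_comm 3 k, pairOcc_comm 4 k, pairOcc_comm 5 k]

lemma H0_mulVec_i {k l : Fin 9} (hk : k < 3) (hl : 6 ≤ l) (v : Idx → ℂ) :
    (H0 *ᵥ v) (pairOcc k l) =
      (v (pairOcc 0 l) + v (pairOcc 1 l) + v (pairOcc 2 l)) + v (pairOcc k l) := by
  rw [H0, add_mulVec, Pi.add_apply, H0i_mulVec_of_mem hk (by grind),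
    H0j_mulVec_of_notMem (Or.inl hk) (Or.inr hl)]

lemma H0_mulVec_j {k l : Fin 9} (hk : 3 ≤ k ∧ k < 6) (hl : 6 ≤ l) (v : Idx → ℂ) :
    (H0 *ᵥ v) (pairOcc k l) =
      v (pairOcc k l) + (v (pairOcc 3 l) + v (pairOcc 4 l) + v (pairOcc 5 l)) := by
  rw [H0, add_mulVec, Pi.add_apply, H0i_mulVec_of_notMem hk.1 (by grind),
    H0j_mulVec_of_mem hk (Or.inr hl)]

lemma H0_mulVec_mediator {k l : Fin 9} (hk : 6 ≤ k) (hl : 6 ≤ l) (v : Idx → ℂ) :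
    (H0 *ᵥ v) (pairOcc k l) = v (pairOcc k l) + v (pairOcc k l) := by
  rw [H0, add_mulVec, Pi.add_apply, H0i_mulVec_of_notMem (by grind) (by grind),
    H0j_mulVec_of_notMem (Or.inr hk) (Or.inr hl)]

/-- The condition that an occupation vector labels a basis state of the constrained subspace. -/
abbrev Allowed (t : Idx) : Prop := IndepSet (suppOf t) ∧ (suppOf t).card = 2

/-- The ordered non-adjacent pairs of modes. -/
def nonAdjPairs : Finset (Fin 9 × Fin 9) :=
  Finset.univ.filter fun q => q.1 < q.2 ∧ ¬ Adj q.1 q.2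

lemma suppOf_pairOcc (k l : Fin 9) : suppOf (pairOcc k l) = {k, l} := by
  ext m; simp [suppOf, pairOcc]

lemma Adj.symm {k l : Fin 9} (h : Adj k l) : Adj l k := Or.symm h

lemma not_adj_self (k : Fin 9) : ¬ Adj k k := by revert k; decide

lemma allowed_pairOcc_iff {k l : Fin 9} : Allowed (pairOcc k l) ↔ k ≠ l ∧ ¬ Adj k l := by
  rw [Allowed, suppOf_pairOcc]
  by_cases h : k = l
  · simp [h]
  · simp only [IndepSet, Finset.card_pair h, and_true, ne_eq, h, not_false_eq_true, true_and,
      Finset.mem_insert, Finset.mem_singleton, forall_eq_or_imp, forall_eq, not_adj_self]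
    exact ⟨fun h => h.1, fun h => ⟨h, fun h' => h h'.symm⟩⟩

lemma allowed_iff (t : Idx) : Allowed t ↔ ∃ q ∈ nonAdjPairs, pairOcc q.1 q.2 = t := by
  constructor
  · intro ht
    obtain ⟨k, l, hkl, hs⟩ := Finset.card_eq_two.1 ht.2
    have e : t = pairOcc k l := by
      funext m
      have := congrArg (m ∈ ·) hs
      simp only [suppOf, Finset.mem_filter, Finset.mem_univ, true_and, Finset.mem_insert,
        Finset.mem_singleton, eq_iff_iff] at this
      rw [pairOcc, Bool.eq_iff_iff, this, decide_eq_true_eq]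
    subst e
    have hA := (allowed_pairOcc_iff.1 ht).2
    rcases lt_or_gt_of_ne hkl with h | h
    · exact ⟨(k, l), by simp [nonAdjPairs, h, hA], rfl⟩
    · exact ⟨(l, k), by simpa [nonAdjPairs, h] using fun h' : Adj l k => hA h'.symm,
        pairOcc_comm l k⟩
  · rintro ⟨q, hq, rfl⟩
    simp only [nonAdjPairs, Finset.mem_filter, Finset.mem_univ, true_and] at hq
    exact allowed_pairOcc_iff.2 ⟨hq.1.ne, hq.2⟩

lemma pairOcc_inj {k l k' l' : Fin 9} (h : k < l) (h' : k' < l')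
    (e : pairOcc k l = pairOcc k' l') : k = k' ∧ l = l' := by
  have h1 := congrFun e k
  have h2 := congrFun e l
  have h3 := congrFun e k'
  simp only [pairOcc] at h1 h2 h3
  grind

lemma sum_eq_sum_nonAdjPairs {f : Idx → ℂ} (hf : ∀ t, ¬ Allowed t → f t = 0) :
    ∑ t, f t = ∑ q ∈ nonAdjPairs, f (pairOcc q.1 q.2) := by
  rw [← Finset.sum_image (f := f) (g := fun q : Fin 9 × Fin 9 => pairOcc q.1 q.2)]
  · refine (Finset.sum_subset (Finset.subset_univ _) fun t _ ht => hf t fun h => ht ?_).symm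
    obtain ⟨q, hq, e⟩ := (allowed_iff t).1 h
    exact Finset.mem_image.2 ⟨q, hq, e⟩
  · intro q hq q' hq' e
    simp only [nonAdjPairs, Finset.coe_filter, Finset.mem_univ, true_and, Set.mem_ofPred_eq] at hq hq'
    exact Prod.ext_iff.2 (pairOcc_inj hq.1 hq'.1 e)

lemma nonAdjPairs_eq : nonAdjPairs =
    {(0, 3), (0, 4), (0, 5), (1, 3), (1, 4), (1, 5), (2, 3), (2, 4), (2, 5),
      (0, 6), (2, 6), (0, 7), (1, 7), (1, 8), (2, 8),
      (3, 6), (5, 6), (3, 7), (4, 7), (4, 8), (5, 8), (6, 7), (6, 8), (7, 8)} := by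
  decide

lemma fock_eq_single (S : Finset (Fin 9)) :
    fock S = Pi.single (fun k => decide (k ∈ S)) 1 := by
  funext t
  simp [fock, Pi.single_apply]

lemma mem_C2_iff {v : Idx → ℂ} : v ∈ C2 ↔ ∀ t, ¬ Allowed t → v t = 0 := by
  constructor
  · intro hv t ht
    induction hv using Submodule.span_induction with
    | mem x hx =>
      obtain ⟨S, hS, hc, rfl⟩ := hx
      rw [fock, if_neg]
      rintro rfl
      have : suppOf (fun k => decide (k ∈ S)) = S := by ext; simp [suppOf]
      exact ht ⟨by rwa [this], by rwa [this]⟩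
    | zero => rfl
    | add x y _ _ hx hy => simp [hx, hy]
    | smul c x _ hx => simp [hx]
  · intro h
    rw [pi_eq_sum_univ' v]
    refine Submodule.sum_mem _ fun t _ => ?_
    by_cases ht : Allowed t
    · refine Submodule.smul_mem _ _ (Submodule.subset_span ⟨suppOf t, ht.1, ht.2, ?_⟩)
      rw [fock_eq_single]
      congr 1
      funext k
      simp [suppOf]
    · simp [h t ht]

lemma Pic_mulVec_of_mem {v : Idx → ℂ} (hv : v ∈ C2) : Pic *ᵥ v = v := by
  funext t
  rw [Pic, mulVec_diagonal]
  split_ifs with h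
  · simp
  · simp [mem_C2_iff.1 hv t h]

lemma apply_pairOcc_eq_zero {v : Idx → ℂ} (hv : v ∈ C2) {k l : Fin 9} (h : Adj k l) :
    v (pairOcc k l) = 0 :=
  mem_C2_iff.1 hv _ fun ht => (allowed_pairOcc_iff.1 ht).2 h

/-- The coefficients of the encoded one-qubit states on the three modes of a triangle. -/
def encCoeff (b : Fin 2) : Fin 3 → ℂ :=
  if b = 0 then ![-2 / (2 * s3), (1 + s3) / (2 * s3), (1 - s3) / (2 * s3)]
  else ![-2 / (2 * s3), (1 - s3) / (2 * s3), (1 + s3) / (2 * s3)]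

lemma Senc_eq (k1 k2 k3 : Fin 9) (b : Fin 2) :
    Senc k1 k2 k3 b =
      encCoeff b 0 • ad k1 + encCoeff b 1 • ad k2 + encCoeff b 2 • ad k3 := by
  fin_cases b <;> simp [Senc, encCoeff, smul_add, smul_sub, smul_smul, div_eq_mul_inv] <;> module

lemma ad_mul_ad_mulVec_vac {k l : Fin 9} (h : k < l) :
    ad k *ᵥ (ad l *ᵥ vac) = Pi.single (pairOcc k l) 1 := by
  funext t
  rw [ad_mulVec, ad_mulVec, Pi.single_apply]
  simp only [vac]
  by_cases ht : t = pairOcc k l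
  · subst ht
    have e : Function.update (Function.update (pairOcc k l) k false) l false
        = fun _ => false := by
      funext m
      simp only [Function.update_apply, pairOcc]
      grind
    have hs : jwSign l (Function.update (pairOcc k l) k false) = 1 := by
      rw [jwSign_congr (t := fun _ => false)]
      · simp [jwSign]
      · intro m hm
        simp only [Function.update_apply, pairOcc]
        grind
    rw [e, hs, jwSign_pairOcc, if_neg (not_lt.2 h.le)]
    simp [pairOcc, h.ne']
  · rw [if_neg ht]
    split_ifs with h1 h2 h3
    · exfalso
      apply ht
      funext m
      have := congrFun h3 m
      simp only [Function.update_apply] at this h2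
      simp only [pairOcc]
      grind
    all_goals simp

/-- The modes of the first triangle. -/
def iMode : Fin 3 → Fin 9 := ![0, 1, 2]

/-- The modes of the second triangle. -/
def jMode : Fin 3 → Fin 9 := ![3, 4, 5]

lemma enc_eq (b b' : Fin 2) :
    enc b b' = ∑ k, ∑ l, (encCoeff b k * encCoeff b' l) •
      (Pi.single (pairOcc (iMode k) (jMode l)) 1 : Idx → ℂ) := by
  rw [enc, ← mulVec_mulVec, Senc_eq, Senc_eq]
  simp only [add_mulVec, mulVec_add, smul_mulVec, mulVec_smul, Fin.sum_univ_three]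
  rw [ad_mul_ad_mulVec_vac (by decide), ad_mul_ad_mulVec_vac (by decide),
    ad_mul_ad_mulVec_vac (by decide), ad_mul_ad_mulVec_vac (by decide),
    ad_mul_ad_mulVec_vac (by decide), ad_mul_ad_mulVec_vac (by decide),
    ad_mul_ad_mulVec_vac (by decide), ad_mul_ad_mulVec_vac (by decide),
    ad_mul_ad_mulVec_vac (by decide)]
  simp only [iMode, jMode, Matrix.cons_val]
  module

lemma iMode_lt_jMode (k l : Fin 3) : iMode k < jMode l := by revert k l; decide

lemma pairOcc_mode_eq_iff {k l k' l' : Fin 3} :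
    pairOcc (iMode k) (jMode l) = pairOcc (iMode k') (jMode l') ↔ k = k' ∧ l = l' := by
  constructor
  · intro e
    have := pairOcc_inj (iMode_lt_jMode k l) (iMode_lt_jMode k' l') e
    revert k l k' l'
    decide +revert
  · rintro ⟨rfl, rfl⟩; rfl

lemma enc_mem_C2 (b b' : Fin 2) : enc b b' ∈ C2 := by
  rw [mem_C2_iff, enc_eq]
  intro t ht
  simp only [Finset.sum_apply, Pi.smul_apply, Pi.single_apply]
  refine Finset.sum_eq_zero fun k _ => Finset.sum_eq_zero fun l _ => ?_
  rw [if_neg, smul_zero]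
  rintro rfl
  refine ht (allowed_pairOcc_iff.2 ⟨(iMode_lt_jMode k l).ne, ?_⟩)
  revert k l
  decide

lemma enc_apply_pairOcc (b b' : Fin 2) (k l : Fin 3) :
    enc b b' (pairOcc (iMode k) (jMode l)) = encCoeff b k * encCoeff b' l := by
  rw [enc_eq]
  simp only [Finset.sum_apply, Pi.smul_apply, Pi.single_apply, pairOcc_mode_eq_iff]
  rw [Finset.sum_eq_single k, Finset.sum_eq_single l] <;> simp +contextual [eq_comm]

lemma enc_apply_eq_zero (b b' : Fin 2) {k l : Fin 9} (hkl : k < l) (hl : 6 ≤ l) :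
    enc b b' (pairOcc k l) = 0 := by
  rw [enc_eq]
  simp only [Finset.sum_apply, Pi.smul_apply, Pi.single_apply]
  refine Finset.sum_eq_zero fun k' _ => Finset.sum_eq_zero fun l' _ => ?_
  rw [if_neg, smul_zero]
  intro e
  have h := (pairOcc_inj hkl (iMode_lt_jMode k' l') e).2
  subst h
  revert hl
  clear * -
  revert l'
  decide

lemma s3_sq : s3 * s3 = 3 := by
  rw [s3, ← Complex.ofReal_mul, Real.mul_self_sqrt (by norm_num)]
  norm_num

lemma s3_ne_zero : s3 ≠ 0 := by
  intro h
  have := s3_sq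
  simp [h] at this

lemma star_encCoeff (b : Fin 2) (k : Fin 3) : star (encCoeff b k) = encCoeff b k := by
  have : (starRingEnd ℂ) s3 = s3 := by simp [s3]
  fin_cases b <;> fin_cases k <;> simp [encCoeff, this]

lemma sum_encCoeff (b : Fin 2) : encCoeff b 0 + encCoeff b 1 + encCoeff b 2 = 0 := by
  fin_cases b <;> simp [encCoeff] <;> ring

lemma encCoeff_dotProduct (b c : Fin 2) :
    ∑ k, encCoeff b k * encCoeff c k = if b = c then 1 else 0 := by
  have h := s3_ne_zero
  have h2 := s3_sq
  rw [Fin.sum_univ_three]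
  fin_cases b <;> fin_cases c <;> simp [encCoeff] <;> field_simp <;> grind

lemma star_enc_dotProduct (b b' : Fin 2) (v : Idx → ℂ) :
    star (enc b b') ⬝ᵥ v =
      ∑ k, ∑ l, encCoeff b k * encCoeff b' l * v (pairOcc (iMode k) (jMode l)) := by
  rw [enc_eq]
  simp only [star_sum, star_smul, star_mul', star_encCoeff, sum_dotProduct, smul_dotProduct,
    Pi.star_single, star_one, single_dotProduct, one_mul, smul_eq_mul]

lemma enc_orthonormal (b b' c c' : Fin 2) :
    star (enc b b') ⬝ᵥ enc c c' = if b = c ∧ b' = c' then 1 else 0 := by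
  rw [star_enc_dotProduct]
  simp only [enc_apply_pairOcc]
  rw [show (if b = c ∧ b' = c' then (1 : ℂ) else 0)
    = (if b = c then 1 else 0) * (if b' = c' then 1 else 0) by split_ifs <;> simp_all,
    ← encCoeff_dotProduct, ← encCoeff_dotProduct, Finset.sum_mul_sum]
  exact Finset.sum_congr rfl fun k _ => Finset.sum_congr rfl fun l _ => by ring

lemma Pic_H0_Pic_enc (b b' : Fin 2) : (Pic * H0 * Pic) *ᵥ enc b b' = 0 := by
  rw [← mulVec_mulVec, Pic_mulVec_of_mem (enc_mem_C2 b b'), ← mulVec_mulVec]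
  funext t
  rw [Pic, mulVec_diagonal]
  split_ifs with ht
  swap
  · simp
  obtain ⟨⟨k, l⟩, hq, rfl⟩ := (allowed_iff t).1 ht
  simp only [nonAdjPairs, Finset.mem_filter, Finset.mem_univ, true_and] at hq
  obtain ⟨hkl, hA⟩ := hq
  rw [one_mul, Pi.zero_apply]
  dsimp only
  have hE := enc_apply_pairOcc b b'
  have hZ : ∀ k l : Fin 9, k < l → 6 ≤ l → enc b b' (pairOcc k l) = 0 :=
    fun _ _ => enc_apply_eq_zero b b'
  rcases lt_or_ge l 6 with hl | hl
  · have hk3 : k < 3 ∧ 3 ≤ l := by clear * - hkl hA hl; revert k l; decide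
    rw [H0_mulVec_ij hk3.1 ⟨hk3.2, hl⟩]
    obtain ⟨k', rfl⟩ : ∃ k', iMode k' = k := by clear * - hk3; revert k; decide +revert
    obtain ⟨l', rfl⟩ : ∃ l', jMode l' = l := by clear * - hk3 hl; revert l; decide +revert
    change enc b b' (pairOcc (iMode 0) _) + enc b b' (pairOcc (iMode 1) _)
      + enc b b' (pairOcc (iMode 2) _) + (enc b b' (pairOcc _ (jMode 0))
      + enc b b' (pairOcc _ (jMode 1)) + enc b b' (pairOcc _ (jMode 2))) = 0
    simp only [hE]
    linear_combination encCoeff b' l' * sum_encCoeff b + encCoeff b k' * sum_encCoeff b'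
  · rcases lt_or_ge k 3 with hk | hk
    · rw [H0_mulVec_i hk hl]
      simp [hZ, hl, hkl, show 0 < l by grind, show 1 < l by grind, show 2 < l by grind]
    rcases lt_or_ge k 6 with hk' | hk'
    · rw [H0_mulVec_j ⟨hk, hk'⟩ hl]
      simp [hZ, hl, hkl, show 3 < l by grind, show 4 < l by grind, show 5 < l by grind]
    · rw [H0_mulVec_mediator hk' hl]
      simp [hZ, hl, hkl]

/-- A vector of `ℂ³` orthogonal to both encoded one-qubit states is constant. -/
lemma eq_of_encCoeff_orthogonal {x : Fin 3 → ℂ} (h : ∀ b, ∑ k, encCoeff b k * x k = 0)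
    (k : Fin 3) : x k = x 0 := by
  have h3 := s3_ne_zero
  have h0 := h 0
  have h1 := h 1
  simp only [Fin.sum_univ_three, encCoeff, if_true, one_ne_zero, if_false,
    Matrix.cons_val] at h0 h1
  field_simp at h0 h1
  have e : x 1 = x 2 := by
    have : s3 * (x 1 - x 2) = 0 := by linear_combination (h0 - h1) / 2
    rcases mul_eq_zero.1 this with h | h
    · exact absurd h h3
    · exact sub_eq_zero.1 h
  fin_cases k
  · rfl
  · change x 1 = x 0
    linear_combination (h0 + h1) / 4 + e / 2
  · change x 2 = x 0
    linear_combination (h0 + h1) / 4 - e / 2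

lemma additive_of_orthogonal {w : Fin 3 → Fin 3 → ℂ}
    (h : ∀ b b', ∑ k, ∑ l, encCoeff b k * encCoeff b' l * w k l = 0) (k l : Fin 3) :
    w k l = w k 0 + w 0 l - w 0 0 := by
  have h1 : ∀ b' k, ∑ l, encCoeff b' l * w k l = ∑ l, encCoeff b' l * w 0 l := fun b' =>
    eq_of_encCoeff_orthogonal (x := fun k => ∑ l, encCoeff b' l * w k l) fun b => by
      rw [← h b b']
      simp only [Finset.mul_sum, mul_assoc]
  have h2 := eq_of_encCoeff_orthogonal (x := fun l => w k l - w 0 l)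
    (fun b' => by simp only [mul_sub, Finset.sum_sub_distrib, h1 b' k, sub_self]) l
  linear_combination h2

/-- For an additive `3 × 3` array, the sum of squares is at most the sum of the squares of the
row sums and column sums. -/
lemma sum_sq_le_of_additive {x : Fin 3 → Fin 3 → ℝ}
    (h : ∀ k l, x k l = x k 0 + x 0 l - x 0 0) :
    ∑ k, ∑ l, x k l ^ 2 ≤ ∑ k, (∑ l, x k l) ^ 2 + ∑ l, (∑ k, x k l) ^ 2 := by
  simp only [Fin.sum_univ_three]
  rw [h 1 1, h 1 2, h 2 1, h 2 2]
  nlinarith [sq_nonneg (x 0 0 - x 1 0), sq_nonneg (x 0 0 - x 2 0), sq_nonneg (x 1 0 - x 2 0),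
    sq_nonneg (x 0 0 - x 0 1), sq_nonneg (x 0 0 - x 0 2), sq_nonneg (x 0 1 - x 0 2),
    sq_nonneg (x 0 0 + x 1 0 + x 2 0 + x 0 1 + x 0 2 - 2 * x 0 0)]

lemma gap {v : Idx → ℂ} (hv : v ∈ C2) (ho : ∀ b b', star (enc b b') ⬝ᵥ v = 0) :
    (star v ⬝ᵥ v).re ≤ (star v ⬝ᵥ H0 *ᵥ v).re := by
  have hadd := additive_of_orthogonal (w := fun k l => v (pairOcc (iMode k) (jMode l)))
    fun b b' => by rw [← star_enc_dotProduct, ho]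
  have hre := sum_sq_le_of_additive (x := fun k l => (v (pairOcc (iMode k) (jMode l))).re)
    fun k l => by simpa using congrArg Complex.re (hadd k l)
  have him := sum_sq_le_of_additive (x := fun k l => (v (pairOcc (iMode k) (jMode l))).im)
    fun k l => by simpa using congrArg Complex.im (hadd k l)
  simp only [Fin.sum_univ_three, iMode, jMode, Matrix.cons_val] at hre him
  have hz := mem_C2_iff.1 hv
  have z16 := apply_pairOcc_eq_zero hv (k := 1) (l := 6) (by decide)
  have z27 := apply_pairOcc_eq_zero hv (k := 2) (l := 7) (by decide)
  have z08 := apply_pairOcc_eq_zero hv (k := 0) (l := 8) (by decide)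
  have z46 := apply_pairOcc_eq_zero hv (k := 4) (l := 6) (by decide)
  have z57 := apply_pairOcc_eq_zero hv (k := 5) (l := 7) (by decide)
  have z38 := apply_pairOcc_eq_zero hv (k := 3) (l := 8) (by decide)
  have hsq : ∀ p q : ℂ, 0 ≤ (p.re + q.re) ^ 2 + (p.im + q.im) ^ 2 := fun p q => by positivity
  have sq (k l : Fin 9) : 0 ≤ (v (pairOcc k l)).re ^ 2 + (v (pairOcc k l)).im ^ 2 := by
    positivity
  simp only [dotProduct, Pi.star_apply]
  rw [sum_eq_sum_nonAdjPairs (fun t ht => by simp [hz t ht]),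
    sum_eq_sum_nonAdjPairs (fun t ht => by simp [hz t ht]), ← sub_nonneg, ← Complex.sub_re,
    ← Finset.sum_sub_distrib, nonAdjPairs_eq]
  simp (disch := decide) only [Finset.sum_insert, Finset.sum_singleton, H0_mulVec_ij, H0_mulVec_i,
    H0_mulVec_j, H0_mulVec_mediator, z16, z27, z08, z46, z57, z38, zero_add, add_zero]
  simp only [Complex.star_def, Complex.mul_re, Complex.add_re, Complex.sub_re, Complex.add_im,
    Complex.conj_re, Complex.conj_im]
  linarith [hsq (v (pairOcc 0 6)) (v (pairOcc 2 6)), hsq (v (pairOcc 0 7)) (v (pairOcc 1 7)),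
    hsq (v (pairOcc 1 8)) (v (pairOcc 2 8)), hsq (v (pairOcc 3 6)) (v (pairOcc 5 6)),
    hsq (v (pairOcc 3 7)) (v (pairOcc 4 7)), hsq (v (pairOcc 4 8)) (v (pairOcc 5 8)),
    sq 6 7, sq 6 8, sq 7 8]

lemma mem_span_of_Pic_H0_Pic_eq_zero {v : Idx → ℂ} (hv : v ∈ C2)
    (h : (Pic * H0 * Pic) *ᵥ v = 0) :
    v ∈ Submodule.span ℂ {w | ∃ b b' : Fin 2, w = enc b b'} := by
  set p : Idx → ℂ := ∑ b, ∑ b', (star (enc b b') ⬝ᵥ v) • enc b b' with hp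
  have hpC : p ∈ C2 := Submodule.sum_mem _ fun b _ => Submodule.sum_mem _ fun b' _ =>
    Submodule.smul_mem _ _ (enc_mem_C2 b b')
  have hps : p ∈ Submodule.span ℂ {w | ∃ b b' : Fin 2, w = enc b b'} :=
    Submodule.sum_mem _ fun b _ => Submodule.sum_mem _ fun b' _ =>
      Submodule.smul_mem _ _ (Submodule.subset_span ⟨b, b', rfl⟩)
  have hpH : (Pic * H0 * Pic) *ᵥ p = 0 := by
    rw [hp]
    simp only [mulVec_sum, mulVec_smul, Pic_H0_Pic_enc, smul_zero, Finset.sum_const_zero]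
  have hd : v - p ∈ C2 := Submodule.sub_mem _ hv hpC
  have hdH : (Pic * H0 * Pic) *ᵥ (v - p) = 0 := by rw [mulVec_sub, h, hpH, sub_zero]
  have hperp : ∀ b b', star (enc b b') ⬝ᵥ (v - p) = 0 := by
    intro b b'
    rw [dotProduct_sub, hp]
    simp only [dotProduct_sum, dotProduct_smul, enc_orthonormal, smul_eq_mul]
    rw [Finset.sum_eq_single b, Finset.sum_eq_single b'] <;> simp +contextual [eq_comm]
  have hg := gap hd hperp
  have hzero : star (v - p) ⬝ᵥ H0 *ᵥ (v - p) = 0 := by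
    have e : star (v - p) = star (v - p) ᵥ* Pic := by
      have hPic : Picᴴ = Pic := by
        rw [Pic, diagonal_conjTranspose]
        congr 1
        funext t
        simp only [Pi.star_apply]
        split_ifs <;> simp
      rw [← hPic, ← star_mulVec, Pic_mulVec_of_mem hd]
    rw [e, ← dotProduct_mulVec, mulVec_mulVec]
    conv_lhs => rw [← Pic_mulVec_of_mem hd, mulVec_mulVec, hdH, dotProduct_zero]
  rw [hzero, Complex.zero_re] at hg
  have hsum : ∑ t, Complex.normSq ((v - p) t) ≤ 0 := by
    refine le_of_eq_of_le ?_ hg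
    simp only [dotProduct, Pi.star_apply, Complex.re_sum, Complex.star_def,
      ← Complex.normSq_eq_conj_mul_self, Complex.ofReal_re]
  have hvp : v - p = 0 := by
    funext t
    have ht := (Finset.sum_eq_zero_iff_of_nonneg fun t _ => Complex.normSq_nonneg _).1
      (le_antisymm hsum (Finset.sum_nonneg fun t _ => Complex.normSq_nonneg _)) t
      (Finset.mem_univ t)
    exact Complex.normSq_eq_zero.1 ht
  rwa [sub_eq_zero.1 hvp]

/-!
STATEMENT 1: The four encoded two-qubit states are orthonormal, lie in the
two-particle constrained subspace, are annihilated by `Π_c H₀ Π_c`, span the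
kernel of `Π_c H₀ Π_c` within that subspace, and any vector of that subspace
orthogonal to all four of them satisfies `⟨v, H₀ v⟩ ≥ ⟨v, v⟩`.
-/

theorem statement1 :
    -- the four encoded states are orthonormal:
    (∀ b b' c c' : Fin 2,
        star (enc b b') ⬝ᵥ enc c c' = if b = c ∧ b' = c' then 1 else 0) ∧
    -- they lie in the two-particle constrained subspace:
    (∀ b b' : Fin 2, enc b b' ∈ C2) ∧
    -- they satisfy (Π_c H₀ Π_c)|bb'⟩_enc = 0:
    (∀ b b' : Fin 2, (Pic * H0 * Pic).mulVec (enc b b') = 0) ∧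
    -- every v in the constrained subspace with (Π_c H₀ Π_c)v = 0 is a linear
    -- combination of the four encoded states:
    (∀ v ∈ C2, (Pic * H0 * Pic).mulVec v = 0 →
        v ∈ Submodule.span ℂ {w | ∃ b b' : Fin 2, w = enc b b'}) ∧
    -- every v in the constrained subspace orthogonal to all four encoded states
    -- satisfies ⟨v, H₀ v⟩ ≥ ⟨v, v⟩:
    (∀ v ∈ C2, (∀ b b' : Fin 2, star (enc b b') ⬝ᵥ v = 0) →
        (star v ⬝ᵥ H0.mulVec v).re ≥ (star v ⬝ᵥ v).re) := by
  exact ⟨enc_orthonormal, enc_mem_C2, Pic_H0_Pic_enc,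
    fun _ => mem_span_of_Pic_H0_Pic_eq_zero, fun _ => gap⟩

end
end

section
/- The perturbation V_main has no first-order effect on the encoded qubits: E† V_main E = 0, where E : ℂ⁴ → ℂ^512 is the isometry sending |b⟩⊗|b'⟩ to |bb'⟩_enc. -/
open Matrix
open scoped Kronecker

noncomputable section

/-- A vector has mode `k` empty if it is supported on occupation vectors not occupying `k`. -/
def ModeEmpty (k : Fin 9) (v : Idx → ℂ) : Prop := ∀ t : Idx, t k = true → v t = 0

theorem a_apply_of_empty {k : Fin 9} {t : Idx} (h : t k = false) (s : Idx) : a k s t = 0 := by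
  simp [a, h]

theorem modeEmpty_vac (k : Fin 9) : ModeEmpty k vac := by
  intro t ht
  have : t ≠ fun _ => false := by
    rintro rfl
    simp at ht
  simp [vac, this]

theorem ModeEmpty.smul {k : Fin 9} {v : Idx → ℂ} (hv : ModeEmpty k v) (c : ℂ) :
    ModeEmpty k (c • v) := fun t ht => by simp [hv t ht]

theorem ModeEmpty.add {k : Fin 9} {v w : Idx → ℂ} (hv : ModeEmpty k v) (hw : ModeEmpty k w) :
    ModeEmpty k (v + w) := fun t ht => by simp [hv t ht, hw t ht]

theorem ModeEmpty.sub {k : Fin 9} {v w : Idx → ℂ} (hv : ModeEmpty k v) (hw : ModeEmpty k w) :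
    ModeEmpty k (v - w) := fun t ht => by simp [hv t ht, hw t ht]

theorem ModeEmpty.ad_mulVec {k l : Fin 9} (hkl : k ≠ l) {v : Idx → ℂ} (hv : ModeEmpty k v) :
    ModeEmpty k (ad l *ᵥ v) := by
  intro t ht
  rw [mulVec, dotProduct]
  refine Finset.sum_eq_zero fun u _ => ?_
  by_cases hul : t l = true ∧ u = Function.update t l false
  · have hk : u k = true := by rw [hul.2, Function.update_of_ne hkl, ht]
    rw [hv u hk, mul_zero]
  · simp only [ad, a, conjTranspose_apply, of_apply, if_neg hul, star_zero, zero_mul]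

theorem ModeEmpty.senc_mulVec {k k₁ k₂ k₃ : Fin 9} (h₁ : k ≠ k₁) (h₂ : k ≠ k₂) (h₃ : k ≠ k₃)
    (b : Fin 2) {v : Idx → ℂ} (hv : ModeEmpty k v) : ModeEmpty k (Senc k₁ k₂ k₃ b *ᵥ v) := by
  unfold Senc
  split_ifs <;> simp only [smul_mulVec, add_mulVec, sub_mulVec] <;>
    exact ((((hv.ad_mulVec h₃).smul _).sub ((hv.ad_mulVec h₁).smul _)).add
      ((hv.ad_mulVec h₂).smul _)).smul _

theorem modeEmpty_enc {k : Fin 9} (hk : 6 ≤ k) (b b' : Fin 2) : ModeEmpty k (enc b b') := by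
  unfold enc
  rw [← mulVec_mulVec]
  apply_rules [ModeEmpty.senc_mulVec, modeEmpty_vac] <;> rintro rfl <;> revert hk <;> decide

/-- Hopping terms have no matrix elements between states leaving the target or source empty. -/
theorem ad_mul_a_apply_eq_zero {k l : Fin 9} {s t : Idx} (h : s k = false ∨ t l = false) :
    (ad k * a l) s t = 0 := by
  rw [Matrix.mul_apply]
  refine Finset.sum_eq_zero fun u _ => ?_
  rcases h with h | h <;> simp [ad, a_apply_of_empty h]

theorem vmain_apply_eq_zero {s t : Idx} (hs : ∀ k : Fin 9, 6 ≤ k → s k = false)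
    (ht : ∀ k : Fin 9, 6 ≤ k → t k = false) : Vmain s t = 0 := by
  have hl (k l : Fin 9) (hk : 6 ≤ k) : (ad k * a l) s t = 0 :=
    ad_mul_a_apply_eq_zero (.inl (hs k hk))
  have hr (k l : Fin 9) (h : 6 ≤ l) : (ad k * a l) s t = 0 :=
    ad_mul_a_apply_eq_zero (.inr (ht l h))
  simp only [Vmain, V1, V2, Matrix.add_apply]
  simp [hl 6 _ (by decide), hl 7 _ (by decide), hl 8 _ (by decide),
    hr _ 6 (by decide), hr _ 7 (by decide), hr _ 8 (by decide)]

theorem eenc_apply_eq_zero {t : Idx} (ht : ¬ ∀ k : Fin 9, 6 ≤ k → t k = false)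
    (p : Fin 2 × Fin 2) : Eenc t p = 0 := by
  push Not at ht
  obtain ⟨k, hk, htk⟩ := ht
  exact modeEmpty_enc hk p.1 p.2 t (by simpa using htk)

/-!
STATEMENT 2: The perturbation `V_main` has no first-order effect on the
encoded qubits: `E† V_main E = 0`.
-/

theorem statement2 : Eencᴴ * Vmain * Eenc = 0 := by
  ext p q
  rw [Matrix.mul_apply]
  refine Finset.sum_eq_zero fun t _ => ?_
  by_cases ht : ∀ k : Fin 9, 6 ≤ k → t k = false
  · rw [Matrix.mul_apply, Finset.sum_eq_zero, zero_mul]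
    intro s _
    by_cases hs : ∀ k : Fin 9, 6 ≤ k → s k = false
    · rw [vmain_apply_eq_zero hs ht, mul_zero]
    · rw [conjTranspose_apply, eenc_apply_eq_zero hs, star_zero, zero_mul]
  · rw [eenc_apply_eq_zero ht, mul_zero]

end
end

section
/- The states ψ± := (1/√2) a_x†(a_{j1}† ± a_{j3}†)|vac⟩ lie in the two-particle constrained subspace and are eigenvectors of Π_c H₀ Π_c with eigenvalues 3 (for ψ₊) and 1 (for ψ₋). -/
open Matrix
open scoped Kronecker

noncomputable section

/-- `√2` as a complex number. -/
def s2 : ℂ := (Real.sqrt 2 : ℝ)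

/-- `ψ₊ = (1/√2) a_x†(a_{j1}† + a_{j3}†)|vac⟩`. -/
def psiP : Idx → ℂ := ((1 / s2) • (ad 6 * (ad 3 + ad 5))).mulVec vac

/-- `ψ₋ = (1/√2) a_x†(a_{j1}† − a_{j3}†)|vac⟩`. -/
def psiM : Idx → ℂ := ((1 / s2) • (ad 6 * (ad 3 - ad 5))).mulVec vac

theorem a_mulVec_fock (k : Fin 9) (S : Finset (Fin 9)) :
    a k *ᵥ fock S =
      if k ∈ S then (-1 : ℂ) ^ (S.filter (· < k)).card • fock (S.erase k) else 0 := by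
  have hfilter : (Finset.univ.filter fun l => l < k ∧ l ∈ S) = S.filter (· < k) := by
    ext l
    simp [and_comm]
  have hupdate : Function.update (fun l => decide (l ∈ S)) k false =
      fun l => decide (l ∈ S.erase k) := by
    funext l
    by_cases h : l = k <;> simp [h]
  ext s
  by_cases hk : k ∈ S <;>
    simp [mulVec, dotProduct, fock, a, hk, hupdate, hfilter]

theorem ad_mulVec_fock (k : Fin 9) (S : Finset (Fin 9)) :
    ad k *ᵥ fock S =
      if k ∈ S then 0 else (-1 : ℂ) ^ (S.filter (· < k)).card • fock (insert k S) := by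
  ext t
  have hlhs : (ad k *ᵥ fock S) t = star (a k (fun l => decide (l ∈ S)) t) := by
    simp [mulVec, dotProduct, fock, ad]
  rw [hlhs]
  by_cases hk : k ∈ S
  · have : ¬ (t k = true ∧ (fun l => decide (l ∈ S)) = Function.update t k false) := by
      rintro ⟨-, h⟩
      simpa [hk] using congrFun h k
    simp [a, hk, this]
  · have hiff : (t k = true ∧ (fun l => decide (l ∈ S)) = Function.update t k false) ↔
        t = fun l => decide (l ∈ insert k S) := by
      constructor
      · rintro ⟨ht, h⟩
        funext l
        by_cases hl : l = k
        · simp [hl, ht]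
        · simpa [hl] using (congrFun h l).symm
      · rintro rfl
        refine ⟨by simp, funext fun l => ?_⟩
        by_cases hl : l = k <;> simp [hl, hk]
    by_cases ht : t = fun l => decide (l ∈ insert k S)
    · have hfilter : (Finset.univ.filter fun l => l < k ∧ t l = true) = S.filter (· < k) := by
        ext l
        simp only [ht, Finset.mem_filter, Finset.mem_univ, true_and, decide_eq_true_eq,
          Finset.mem_insert]
        constructor
        · rintro ⟨h, rfl | h'⟩
          · exact absurd h (lt_irrefl _)
          · exact ⟨h', h⟩
        · exact fun h => ⟨h.2, Or.inr h.1⟩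
      simp only [a, of_apply, if_pos (hiff.2 ht), hfilter, if_neg hk]
      simp [fock, ht]
    · simp only [a, of_apply, if_neg (mt hiff.1 ht), if_neg hk]
      simp only [fock, Pi.smul_apply, if_neg ht, star_zero, smul_zero]

theorem Pic_mulVec_fock (S : Finset (Fin 9)) :
    Pic *ᵥ fock S = if IndepSet S ∧ S.card = 2 then fock S else 0 := by
  have hsupp : suppOf (fun k => decide (k ∈ S)) = S := by
    ext
    simp [suppOf]
  ext t
  rw [Pic, mulVec_diagonal]
  by_cases ht : t = fun k => decide (k ∈ S)
  · subst ht
    rw [hsupp]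
    split_ifs <;> simp
  · split_ifs <;> simp [fock, ht]

theorem vac_eq_fock : vac = fock ∅ := by
  funext t
  simp [vac, fock]

theorem Pic_H0_Pic_mulVec_fock_three_six :
    (Pic * H0 * Pic) *ᵥ fock {3, 6} = (2 : ℂ) • fock {3, 6} + fock {5, 6} := by
  have h36 : IndepSet {3, 6} := by decide
  have h46 : ¬ IndepSet {4, 6} := by decide
  have h56 : IndepSet {5, 6} := by decide
  have herase : ({3, 6} : Finset (Fin 9)).erase 3 = {6} := by decide
  have hsign : ∀ k ≤ 5, (({6} : Finset (Fin 9)).filter (· < k)).card = 0 := by decide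
  have hsign' : (({3, 6} : Finset (Fin 9)).filter (· < 3)).card = 0 := by decide
  have hH0 : H0 *ᵥ fock {3, 6} = (2 : ℂ) • fock {3, 6} + fock {4, 6} + fock {5, 6} := by
    simp [H0, H0i, H0j, add_mulVec, ← mulVec_mulVec, a_mulVec_fock, ad_mulVec_fock, herase,
      hsign, hsign']
    module
  simp [← mulVec_mulVec, Pic_mulVec_fock, hH0, mulVec_add, mulVec_smul, h36, h46, h56]

theorem Pic_H0_Pic_mulVec_fock_five_six :
    (Pic * H0 * Pic) *ᵥ fock {5, 6} = (2 : ℂ) • fock {5, 6} + fock {3, 6} := by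
  have h36 : IndepSet {3, 6} := by decide
  have h46 : ¬ IndepSet {4, 6} := by decide
  have h56 : IndepSet {5, 6} := by decide
  have herase : ({5, 6} : Finset (Fin 9)).erase 5 = {6} := by decide
  have hsign : ∀ k ≤ 5, (({6} : Finset (Fin 9)).filter (· < k)).card = 0 := by decide
  have hsign' : (({5, 6} : Finset (Fin 9)).filter (· < 5)).card = 0 := by decide
  have hH0 : H0 *ᵥ fock {5, 6} = (2 : ℂ) • fock {5, 6} + fock {4, 6} + fock {3, 6} := by
    simp [H0, H0i, H0j, add_mulVec, ← mulVec_mulVec, a_mulVec_fock, ad_mulVec_fock, herase,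
      hsign, hsign']
    module
  simp [← mulVec_mulVec, Pic_mulVec_fock, hH0, mulVec_add, mulVec_smul, h36, h46, h56]

theorem ad_six_mul_ad_mulVec_vac {k : Fin 9} (hk : k < 6) :
    (ad 6 * ad k) *ᵥ vac = -fock {k, 6} := by
  have hfilter : ({k} : Finset (Fin 9)).filter (· < 6) = {k} := by simp [hk]
  simp [vac_eq_fock, ← mulVec_mulVec, ad_mulVec_fock, hk.ne', hfilter, Finset.pair_comm]

theorem psiP_eq : psiP = (1 / s2) • (-fock {3, 6} - fock {5, 6}) := by
  rw [psiP, smul_mulVec, mul_add, add_mulVec, ad_six_mul_ad_mulVec_vac (by decide),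
    ad_six_mul_ad_mulVec_vac (by decide), sub_eq_add_neg]

theorem psiM_eq : psiM = (1 / s2) • (-fock {3, 6} + fock {5, 6}) := by
  rw [psiM, smul_mulVec, mul_sub, sub_mulVec, ad_six_mul_ad_mulVec_vac (by decide),
    ad_six_mul_ad_mulVec_vac (by decide), sub_neg_eq_add]

theorem s2_ne_zero : s2 ≠ 0 := by
  simp [s2]

theorem fock_mem_C2 {S : Finset (Fin 9)} (hS : IndepSet S) (hcard : S.card = 2) :
    fock S ∈ C2 :=
  Submodule.subset_span ⟨S, hS, hcard, rfl⟩

/-!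
STATEMENT 3: `ψ±` lie in the two-particle constrained subspace and are
eigenvectors of `Π_c H₀ Π_c` with eigenvalues 3 (for `ψ₊`) and 1 (for `ψ₋`).
-/

theorem statement3 :
    psiP ∈ C2 ∧ psiM ∈ C2 ∧ psiP ≠ 0 ∧ psiM ≠ 0 ∧
    (Pic * H0 * Pic).mulVec psiP = (3 : ℂ) • psiP ∧
    (Pic * H0 * Pic).mulVec psiM = (1 : ℂ) • psiM := by
  have h36 : fock {3, 6} ∈ C2 := fock_mem_C2 (by decide) (by decide)
  have h56 : fock {5, 6} ∈ C2 := fock_mem_C2 (by decide) (by decide)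
  have h36_self : fock {3, 6} (fun k => decide (k ∈ ({3, 6} : Finset (Fin 9)))) = 1 :=
    if_pos rfl
  have h56_apply : fock {5, 6} (fun k => decide (k ∈ ({3, 6} : Finset (Fin 9)))) = 0 :=
    if_neg (by decide)
  rw [psiP_eq, psiM_eq]
  refine ⟨C2.smul_mem _ (C2.sub_mem (C2.neg_mem h36) h56),
    C2.smul_mem _ (C2.add_mem (C2.neg_mem h36) h56), fun h => ?_, fun h => ?_, ?_, ?_⟩
  · have := congrFun h fun k => decide (k ∈ ({3, 6} : Finset (Fin 9)))
    rw [Pi.smul_apply, Pi.sub_apply, Pi.neg_apply, h36_self, h56_apply] at this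
    simp [s2_ne_zero] at this
  · have := congrFun h fun k => decide (k ∈ ({3, 6} : Finset (Fin 9)))
    rw [Pi.smul_apply, Pi.add_apply, Pi.neg_apply, h36_self, h56_apply] at this
    simp [s2_ne_zero] at this
  · rw [mulVec_smul, mulVec_sub, mulVec_neg, Pic_H0_Pic_mulVec_fock_three_six,
      Pic_H0_Pic_mulVec_fock_five_six]
    module
  · rw [mulVec_smul, mulVec_add, mulVec_neg, Pic_H0_Pic_mulVec_fock_three_six,
      Pic_H0_Pic_mulVec_fock_five_six]
    module

end
end

section
/- The Hamiltonian H_Lap preserves the subspace of hard-core fermions: for every independent set S of G, the vector H_Lap|S⟩ lies in the span of the Fock states |S'⟩ over independent sets S' of G. -/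
open Matrix

noncomputable section

/-- Jordan–Wigner annihilation operator `a_k = Z^{⊗(k-1)} ⊗ σ⁻ ⊗ I^{⊗(n-k)}` on the
Fock space `ℂ^(2^n)` of `n` fermionic modes (indexed by occupation vectors
`Fin n → Bool`, with `false` = unoccupied `|0⟩`), written entrywise. -/
def jwA (n : ℕ) (k : Fin n) : Matrix (Fin n → Bool) (Fin n → Bool) ℂ :=
  Matrix.of fun s t =>
    if t k = true ∧ s = Function.update t k false then
      (-1 : ℂ) ^ (Finset.univ.filter fun l => l < k ∧ t l = true).card
    else 0

/-- Creation operator `a_k†`. -/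
def jwAd (n : ℕ) (k : Fin n) : Matrix (Fin n → Bool) (Fin n → Bool) ℂ := (jwA n k)ᴴ

/-- Number operator `n_k = a_k† a_k`. -/
def numOp (n : ℕ) (k : Fin n) : Matrix (Fin n → Bool) (Fin n → Bool) ℂ :=
  jwAd n k * jwA n k

/-- `P_i = ∏_{j : ij ∈ E} (I − n_j)`, the product over the neighbours of `i` in `G`
(the factors pairwise commute, so the product is taken over the neighbours listed
in increasing order). -/
def projP (n : ℕ) (G : SimpleGraph (Fin n)) [DecidableRel G.Adj] (i : Fin n) :
    Matrix (Fin n → Bool) (Fin n → Bool) ℂ :=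
  (((Finset.univ.filter fun j => G.Adj i j).sort (· ≤ ·)).map
    fun j => (1 : Matrix (Fin n → Bool) (Fin n → Bool) ℂ) - numOp n j).prod

/-- The supercharge `Q = Σ_{i ∈ [n]} u_i P_i a_i`. -/
def Qop (n : ℕ) (G : SimpleGraph (Fin n)) [DecidableRel G.Adj] (u : Fin n → ℝ) :
    Matrix (Fin n → Bool) (Fin n → Bool) ℂ :=
  ∑ i : Fin n, (u i : ℂ) • (projP n G i * jwA n i)

/-- The staggered supersymmetric Hamiltonian `H_Lap = Q†Q + QQ†`. -/
def HLap (n : ℕ) (G : SimpleGraph (Fin n)) [DecidableRel G.Adj] (u : Fin n → ℝ) :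
    Matrix (Fin n → Bool) (Fin n → Bool) ℂ :=
  (Qop n G u)ᴴ * Qop n G u + Qop n G u * (Qop n G u)ᴴ

/-- The Fock basis state `|S⟩` with exactly the modes in `S` occupied. -/
def fockG (n : ℕ) (S : Finset (Fin n)) : (Fin n → Bool) → ℂ :=
  fun t => if t = (fun k => decide (k ∈ S)) then 1 else 0

/-- The support of the occupation vector `t` is an independent set of `G`. -/
def IsHardCore {n : ℕ} (G : SimpleGraph (Fin n)) (t : Fin n → Bool) : Prop :=
  ∀ i j, t i = true → t j = true → ¬ G.Adj i j

/-- `M` maps hard-core Fock states to combinations of hard-core Fock states. -/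
def PreservesHardCore {n : ℕ} (G : SimpleGraph (Fin n))
    (M : Matrix (Fin n → Bool) (Fin n → Bool) ℂ) : Prop :=
  ∀ s t, IsHardCore G t → M s t ≠ 0 → IsHardCore G s

lemma PreservesHardCore.mul {n : ℕ} {G : SimpleGraph (Fin n)}
    {M N : Matrix (Fin n → Bool) (Fin n → Bool) ℂ}
    (hM : PreservesHardCore G M) (hN : PreservesHardCore G N) :
    PreservesHardCore G (M * N) := by
  intro s t ht h
  rw [Matrix.mul_apply] at h
  obtain ⟨r, -, hr⟩ := Finset.exists_ne_zero_of_sum_ne_zero h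
  exact hM s r (hN r t ht (right_ne_zero_of_mul hr)) (left_ne_zero_of_mul hr)

lemma PreservesHardCore.add {n : ℕ} {G : SimpleGraph (Fin n)}
    {M N : Matrix (Fin n → Bool) (Fin n → Bool) ℂ}
    (hM : PreservesHardCore G M) (hN : PreservesHardCore G N) :
    PreservesHardCore G (M + N) := by
  intro s t ht h
  by_cases h0 : M s t = 0
  · exact hN s t ht (by simpa [h0] using h)
  · exact hM s t ht h0

lemma numOp_eq_diagonal (n : ℕ) (k : Fin n) :
    numOp n k = Matrix.diagonal fun t => if t k = true then 1 else 0 := by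
  ext s t
  rw [numOp, jwAd, Matrix.mul_apply, Finset.sum_eq_single (Function.update t k false)]
  · by_cases hst : s = t
    · subst hst
      by_cases hk : s k = true <;> simp [jwA, hk, ← mul_pow]
    · have hne : ¬ ((s k = true ∧ Function.update t k false = Function.update s k false) ∧
          t k = true) := by
        rintro ⟨⟨hs, he⟩, ht⟩
        refine hst (funext fun l => ?_)
        by_cases hl : l = k
        · rw [hl, hs, ht]
        · simpa [hl] using (congrFun he l).symm
      rw [Matrix.diagonal_apply_ne _ hst]
      by_cases ht : t k = true
      · have hs : ¬ (s k = true ∧ Function.update t k false = Function.update s k false) :=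
          fun h => hne ⟨h, ht⟩
        simp only [Matrix.conjTranspose_apply, jwA, Matrix.of_apply, if_neg hs, star_zero, zero_mul]
      · simp [jwA, ht]
  · intro r _ hr
    simp [jwA, hr]
  · simp

lemma projP_eq_diagonal (n : ℕ) (G : SimpleGraph (Fin n)) [DecidableRel G.Adj] (i : Fin n) :
    projP n G i =
      Matrix.diagonal fun t => ∏ j with G.Adj i j, if t j = true then (0 : ℂ) else 1 := by
  have key (L : List (Fin n)) :
      (L.map fun j => (1 : Matrix (Fin n → Bool) (Fin n → Bool) ℂ) - numOp n j).prod =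
        Matrix.diagonal fun t => (L.map fun j => if t j = true then (0 : ℂ) else 1).prod := by
    induction L with
    | nil => simp
    | cons a L ih =>
      rw [List.map_cons, List.prod_cons, ih, numOp_eq_diagonal, ← Matrix.diagonal_one,
        Matrix.diagonal_sub, Matrix.diagonal_mul_diagonal]
      congr 1
      funext t
      by_cases h : t a = true <;> simp [h]
  rw [projP, key]
  congr 1
  funext t
  rw [← List.prod_toFinset _ (Finset.sort_nodup _ _), Finset.sort_toFinset]

/-- A nonzero entry of `Q` removes one particle from a site with no occupied neighbour. -/
lemma exists_of_Qop_ne_zero {n : ℕ} {G : SimpleGraph (Fin n)} [DecidableRel G.Adj]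
    {u : Fin n → ℝ} {s t : Fin n → Bool} (h : Qop n G u s t ≠ 0) :
    ∃ i, (∀ j, G.Adj i j → s j = false) ∧ s = Function.update t i false := by
  rw [Qop, Matrix.sum_apply] at h
  obtain ⟨i, -, hi⟩ := Finset.exists_ne_zero_of_sum_ne_zero h
  rw [Matrix.smul_apply, projP_eq_diagonal, Matrix.diagonal_mul] at hi
  have hi := right_ne_zero_of_mul hi
  refine ⟨i, fun j hj => ?_, ?_⟩
  · simpa using Finset.prod_ne_zero_iff.mp (left_ne_zero_of_mul hi) j (by simpa using hj)
  · by_contra hs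
    exact right_ne_zero_of_mul hi (by simp [jwA, hs])

lemma preservesHardCore_Qop {n : ℕ} (G : SimpleGraph (Fin n)) [DecidableRel G.Adj]
    (u : Fin n → ℝ) : PreservesHardCore G (Qop n G u) := by
  intro s t ht h
  obtain ⟨i, -, rfl⟩ := exists_of_Qop_ne_zero h
  have hle (a : Fin n) (ha : Function.update t i false a = true) : t a = true := by
    by_cases hai : a = i
    · simp [hai] at ha
    · simpa [hai] using ha
  exact fun a b ha hb => ht a b (hle a ha) (hle b hb)

lemma preservesHardCore_Qop_conjTranspose {n : ℕ} (G : SimpleGraph (Fin n)) [DecidableRel G.Adj]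
    (u : Fin n → ℝ) : PreservesHardCore G (Qop n G u)ᴴ := by
  intro s t ht h
  rw [Matrix.conjTranspose_apply, star_ne_zero] at h
  obtain ⟨i, hnb, rfl⟩ := exists_of_Qop_ne_zero h
  have hup (a : Fin n) (ha : s a = true) (hai : a ≠ i) :
      Function.update s i false a = true := by simpa [hai] using ha
  intro a b ha hb hab
  by_cases hai : a = i
  · subst hai
    exact absurd (hup b hb hab.ne') (by simp [hnb b hab])
  · by_cases hbi : b = i
    · subst hbi
      exact absurd (hup a ha hai) (by simp [hnb a hab.symm])
    · exact ht a b (hup a ha hai) (hup b hb hbi) hab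

lemma preservesHardCore_HLap {n : ℕ} (G : SimpleGraph (Fin n)) [DecidableRel G.Adj]
    (u : Fin n → ℝ) : PreservesHardCore G (HLap n G u) :=
  have hQ := preservesHardCore_Qop G u
  have hQ' := preservesHardCore_Qop_conjTranspose G u
  (hQ'.mul hQ).add (hQ.mul hQ')

lemma fockG_eq_single (n : ℕ) (S : Finset (Fin n)) :
    fockG n S = Pi.single (fun k => decide (k ∈ S)) 1 := by
  funext t
  simp [fockG, Pi.single_apply]

/-!
STATEMENT 11: `H_Lap` preserves the hard-core subspace: for every independent
set `S` of `G`, the vector `H_Lap |S⟩` lies in the span of the Fock states `|S'⟩`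
over independent sets `S'` of `G`.
-/

theorem statement11 (n : ℕ) (G : SimpleGraph (Fin n)) [DecidableRel G.Adj]
    (u : Fin n → ℝ) (hu : ∀ i, 0 ≤ u i)
    (S : Finset (Fin n)) (hS : ∀ i ∈ S, ∀ j ∈ S, ¬ G.Adj i j) :
    (HLap n G u).mulVec (fockG n S) ∈
      Submodule.span ℂ
        {v | ∃ S' : Finset (Fin n), (∀ i ∈ S', ∀ j ∈ S', ¬ G.Adj i j) ∧ v = fockG n S'} := by
  rw [fockG_eq_single, Matrix.mulVec_single_one, pi_eq_sum_univ' (Matrix.col _ _)]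
  refine Submodule.sum_mem _ fun s _ => ?_
  by_cases h : HLap n G u s (fun k => decide (k ∈ S)) = 0
  · simp [Matrix.col_apply, h]
  · have hs := preservesHardCore_HLap G u s _
      (fun i j hi hj => hS i (by simpa using hi) j (by simpa using hj)) h
    refine Submodule.smul_mem _ _ (Submodule.subset_span
      ⟨Finset.univ.filter fun k => s k = true, fun i hi j hj =>
        hs i j (by simpa using hi) (by simpa using hj), ?_⟩)
    have hsupp : (fun k => decide (k ∈ Finset.univ.filter fun k => s k = true)) = s := by
      funext k
      simp
    rw [fockG_eq_single, hsupp]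

end
end
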